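/- arXiv:2501.04728 — 2 statements merged into one kernel-verified Lean document; each statement's English description precedes it below -/
import Mathlib

section
/- Let X = ℓ∞(ℝ) with the supremum norm, let C ⊆ X be the cone of nonnegative functions, and let A ⊆ X be the set of functions f for which there exists a countably infinite set X_f ⊆ ℝ with f(x) = -1 on X_f and f(x) = 0 off X_f. Then for every countable subset S ⊆ A there exists f ∈ A such that f ∉ ⋃_{g ∈ S} (U(g,1) + C), where U(g,1) is the open ball of radius 1 centered at g. In particular, no countable subfamily of the cover {U(f,1) + C : f ∈ A} covers A. -/
open Pointwise Filter Topology

/-- `ℓ∞(ℝ)`: the Banach space of bounded functions from `ℝ` to `ℝ` with the sup norm. -/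
noncomputable abbrev Linf : Type := lp (fun _ : ℝ => ℝ) ⊤

/-- The set `A` of functions equal to `-1` on a countably infinite set and `0` elsewhere. -/
def setA : Set Linf :=
  {f | ∃ S : Set ℝ, S.Countable ∧ S.Infinite ∧ (∀ x ∈ S, f x = -1) ∧ (∀ x ∉ S, f x = 0)}

/-- The cone `C` of nonnegative functions in `ℓ∞(ℝ)`. -/
def coneC : Set Linf := {h | ∀ x : ℝ, 0 ≤ h x}

/-- The negative of the indicator function of a set, as an element of `ℓ∞(ℝ)`. -/
noncomputable def negIndicator (R : Set ℝ) : Linf :=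
  ⟨R.indicator (fun _ => -1), memℓp_infty ⟨1, by
    rintro _ ⟨x, rfl⟩
    by_cases hx : x ∈ R <;> simp [hx]⟩⟩

lemma negIndicator_of_mem {R : Set ℝ} {x : ℝ} (hx : x ∈ R) : negIndicator R x = -1 :=
  Set.indicator_of_mem hx fun _ => (-1 : ℝ)

lemma negIndicator_of_notMem {R : Set ℝ} {x : ℝ} (hx : x ∉ R) : negIndicator R x = 0 :=
  Set.indicator_of_notMem hx fun _ => (-1 : ℝ)

lemma negIndicator_mem_setA {R : Set ℝ} (hc : R.Countable) (hi : R.Infinite) :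
    negIndicator R ∈ setA :=
  ⟨R, hc, hi, fun _ => negIndicator_of_mem, fun _ => negIndicator_of_notMem⟩

lemma Set.Countable.exists_countable_infinite_disjoint {T : Set ℝ} (hT : T.Countable) :
    ∃ R : Set ℝ, R.Countable ∧ R.Infinite ∧ Disjoint R T := by
  have hinf : Tᶜ.Infinite := fun h =>
    Cardinal.not_countable_real (by simpa using hT.union h.countable)
  refine ⟨Set.range fun n => (hinf.natEmbedding Tᶜ n : ℝ), Set.countable_range _,
    Set.infinite_range_of_injective
      (Subtype.val_injective.comp (hinf.natEmbedding Tᶜ).injective), ?_⟩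
  rw [Set.disjoint_left]
  rintro _ ⟨n, rfl⟩
  exact (hinf.natEmbedding Tᶜ n).2

/-- Elements of `U(g, 1) + C` lie strictly above `g - 1` pointwise. -/
lemma sub_one_lt_of_mem_ball_add_coneC {f g : Linf} (hf : f ∈ Metric.ball g 1 + coneC) (x : ℝ) :
    g x - 1 < f x := by
  obtain ⟨u, hu, h, hh, rfl⟩ := Set.mem_add.1 hf
  have hlt : |u x - g x| < 1 :=
    (lp.norm_apply_le_norm ENNReal.top_ne_zero (u - g) x).trans_lt (mem_ball_iff_norm.1 hu)
  have hx : 0 ≤ h x := hh x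
  change g x - 1 < u x + h x
  linarith [(abs_lt.1 hlt).1]

theorem no_countable_subcover (S : Set Linf) (hSc : S.Countable) (hS : S ⊆ setA) :
    (∃ f ∈ setA, f ∉ ⋃ g ∈ S, Metric.ball g 1 + coneC) ∧
      ¬ setA ⊆ ⋃ g ∈ S, Metric.ball g 1 + coneC := by
  suffices hex : ∃ f ∈ setA, f ∉ ⋃ g ∈ S, Metric.ball g 1 + coneC from
    ⟨hex, Set.not_subset.2 hex⟩
  have hT : (⋃ g ∈ S, {x : ℝ | g x ≠ 0}).Countable := by
    refine hSc.biUnion fun g hg => ?_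
    obtain ⟨Y, hY, -, -, hzero⟩ := hS hg
    exact hY.mono fun x hx => by_contra fun hxY => hx (hzero x hxY)
  obtain ⟨R, hRc, hRi, hdisj⟩ := hT.exists_countable_infinite_disjoint
  refine ⟨negIndicator R, negIndicator_mem_setA hRc hRi, fun hmem => ?_⟩
  obtain ⟨g, hg, hfg⟩ := Set.mem_iUnion₂.1 hmem
  obtain ⟨x, hx⟩ := hRi.nonempty
  have hgx : g x = 0 := by_contra fun hne =>
    Set.disjoint_left.1 hdisj hx (Set.mem_iUnion₂.2 ⟨g, hg, hne⟩)
  have hlt := sub_one_lt_of_mem_ball_add_coneC hfg x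
  rw [negIndicator_of_mem hx, hgx] at hlt
  norm_num at hlt
end

section
/- Let X = ℓ∞(ℝ) with the supremum norm, let C ⊆ X be the cone of nonnegative functions, and let A ⊆ X be the set of functions f for which there exists a countably infinite set X_f ⊆ ℝ with f(x) = -1 on X_f and f(x) = 0 off X_f. Then A is not C-compact: there exists a family (U_i)_{i ∈ I} of open subsets of X such that A ⊆ ⋃_{i ∈ I} (U_i + C), yet for every finite subset J ⊆ I one has A ⊄ ⋃_{i ∈ J} (U_i + C). -/
open Pointwise Filter Topology

theorem countable_setOf_ne_zero_of_mem_setA {f : Linf} (hf : f ∈ setA) :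
    {x : ℝ | f x ≠ 0}.Countable := by
  obtain ⟨S, hS, -, -, h0⟩ := hf
  exact hS.mono fun x hx => by_contra fun hxS => hx (h0 x hxS)

theorem exists_mem_setA_apply_eq_neg_one (x : ℝ) : ∃ f ∈ setA, f x = -1 := by
  let S : Set ℝ := insert x (Set.range ((↑) : ℕ → ℝ))
  have hmem : Memℓp (fun y : ℝ => S.indicator (fun _ => (-1 : ℝ)) y) ⊤ := by
    refine memℓp_infty ⟨1, ?_⟩
    rintro _ ⟨y, rfl⟩
    by_cases hy : y ∈ S <;> simp [hy]
  refine ⟨⟨_, hmem⟩, ⟨S, (Set.countable_range _).insert x, ?_, ?_, ?_⟩, ?_⟩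
  · exact (Set.infinite_range_of_injective Nat.cast_injective).mono (Set.subset_insert _ _)
  · exact fun y hy => Set.indicator_of_mem hy (fun _ => (-1 : ℝ))
  · exact fun y hy => Set.indicator_of_notMem hy (fun _ => (-1 : ℝ))
  · exact Set.indicator_of_mem (s := S) (Set.mem_insert x _) (fun _ => (-1 : ℝ))

theorem sub_lt_apply_of_mem_ball_add_coneC {f g : Linf} {r : ℝ}
    (hg : g ∈ Metric.ball f r + coneC) (x : ℝ) : f x - r < g x := by
  obtain ⟨u, hu, c, hc, rfl⟩ := Set.mem_add.1 hg
  have hnorm : ‖(u - f) x‖ < r :=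
    (lp.norm_apply_le_norm ENNReal.top_ne_zero (u - f) x).trans_lt (mem_ball_iff_norm.1 hu)
  have habs : |u x - f x| < r := hnorm
  have hcx : 0 ≤ c x := hc x
  change f x - r < u x + c x
  linarith [(abs_lt.1 habs).1]

theorem setA_not_cone_compact :
    ∃ (I : Type) (U : I → Set Linf), (∀ i, IsOpen (U i)) ∧
      setA ⊆ ⋃ i, U i + coneC ∧
      ∀ J : Finset I, ¬ setA ⊆ ⋃ i ∈ J, U i + coneC := by
  refine ⟨setA, fun f => Metric.ball f.1 (1 / 2), fun f => Metric.isOpen_ball, ?_, ?_⟩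
  · intro f hf
    refine Set.mem_iUnion.2 ⟨⟨f, hf⟩, Set.mem_add.2 ⟨f, ?_, 0, fun x => le_rfl, add_zero f⟩⟩
    exact Metric.mem_ball_self one_half_pos
  · intro J hJ
    have hcount : (⋃ f ∈ J, {x : ℝ | f.1 x ≠ 0}).Countable :=
      J.countable_toSet.biUnion fun f _ => countable_setOf_ne_zero_of_mem_setA f.2
    obtain ⟨x, hx⟩ : ∃ x, x ∉ ⋃ f ∈ J, {x : ℝ | f.1 x ≠ 0} := by
      by_contra! h
      exact Cardinal.not_countable_real (hcount.mono fun x _ => h x)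
    obtain ⟨g, hg, hgx⟩ := exists_mem_setA_apply_eq_neg_one x
    obtain ⟨f, hfJ, hgf⟩ := Set.mem_iUnion₂.1 (hJ hg)
    have hfx : f.1 x = 0 := by_contra fun h => hx (Set.mem_iUnion₂.2 ⟨f, hfJ, h⟩)
    linarith [sub_lt_apply_of_mem_ball_add_coneC hgf x]
end
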